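/- It is undecidable whether the Conway function defined by a given sequence γ, α₀, β₀, …, α_{γ−1}, β_{γ−1} stops; that is, the set of (encodings of) such sequences whose Conway function stops is not computable. -/

import Mathlib

set_option autoImplicit false

/-- The Conway function defined by `γ, α₀, β₀, …, α_{γ−1}, β_{γ−1}`:
`ϝ(n) = n·α_k/β_k` where `k = n mod γ`. -/
def conwayF (γ : ℕ) (α β : List ℕ) (n : ℕ) : ℕ :=
  n * α.getD (n % γ) 0 / β.getD (n % γ) 0

/-- `γ, α, β` are valid data defining a Conway function: all entries are positive,
the lists have length `γ ≥ 1`, and `β_k ∣ γ` and `β_k ∣ k·α_k` for all `k < γ`. -/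
def ConwayData (γ : ℕ) (α β : List ℕ) : Prop :=
  1 ≤ γ ∧ α.length = γ ∧ β.length = γ ∧
  (∀ a ∈ α, 1 ≤ a) ∧ (∀ b ∈ β, 1 ≤ b) ∧
  ∀ k, k < γ → β.getD k 0 ∣ γ ∧ β.getD k 0 ∣ k * α.getD k 0

/-- The Conway function stops: `ϝⁿ(2) = 1` for some `n`. -/
def ConwayStops (γ : ℕ) (α β : List ℕ) : Prop :=
  ∃ n : ℕ, (conwayF γ α β)^[n] 2 = 1

/-- Structured programs on registers indexed by `ℕ`: `loop r c` means
"while register `r` is nonzero, decrement it and execute `c`". -/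
inductive RegProg where
  | skip : RegProg
  | inc (r : ℕ) : RegProg
  | seq (a b : RegProg) : RegProg
  | loop (r : ℕ) (c : RegProg) : RegProg

namespace RegProg

open Function

/-- One step of execution; the first component lists the programs still to be executed. -/
def step : List RegProg × (ℕ → ℕ) → List RegProg × (ℕ → ℕ)
  | ([], σ) => ([], σ)
  | (skip :: k, σ) => (k, σ)
  | (inc r :: k, σ) => (k, update σ r (σ r + 1))
  | (seq a b :: k, σ) => (a :: b :: k, σ)
  | (loop r c :: k, σ) =>
    if σ r = 0 then (k, σ) else (c :: loop r c :: k, update σ r (σ r - 1))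

/-- Executing `c` from the store `σ` terminates with the store `τ`. -/
def Exec (c : RegProg) (σ τ : ℕ → ℕ) : Prop :=
  ∀ k, ∃ j, step^[j] (c :: k, σ) = (k, τ)

theorem exec_skip (σ : ℕ → ℕ) : Exec skip σ σ := fun _ => ⟨1, rfl⟩

theorem exec_inc (r : ℕ) (σ : ℕ → ℕ) : Exec (inc r) σ (update σ r (σ r + 1)) :=
  fun _ => ⟨1, rfl⟩

theorem Exec.seq {a b : RegProg} {σ σ' σ'' : ℕ → ℕ} (ha : Exec a σ σ') (hb : Exec b σ' σ'') :
    Exec (seq a b) σ σ'' := by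
  intro k
  obtain ⟨i, hi⟩ := ha (b :: k)
  obtain ⟨j, hj⟩ := hb k
  refine ⟨j + (i + 1), ?_⟩
  rw [iterate_add_apply, iterate_succ_apply, step, hi, hj]

theorem exec_loop_zero {r : ℕ} {c : RegProg} {σ : ℕ → ℕ} (h : σ r = 0) :
    Exec (loop r c) σ σ := fun k => ⟨1, by simp [step, h]⟩

theorem exec_loop_succ {r : ℕ} {c : RegProg} {σ σ' σ'' : ℕ → ℕ} (h : σ r ≠ 0)
    (hc : Exec c (update σ r (σ r - 1)) σ') (hl : Exec (loop r c) σ' σ'') :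
    Exec (loop r c) σ σ'' := by
  intro k
  obtain ⟨i, hi⟩ := hc (loop r c :: k)
  obtain ⟨j, hj⟩ := hl k
  refine ⟨j + (i + 1), ?_⟩
  rw [iterate_add_apply, iterate_succ_apply, step, if_neg h, hi, hj]

/-- A loop whose successive stores are `s 0, s 1, …, s N`. -/
theorem exec_loop {r : ℕ} {c : RegProg} (N : ℕ) (s : ℕ → ℕ → ℕ)
    (h : ∀ i < N, s i r ≠ 0 ∧ Exec c (update (s i) r (s i r - 1)) (s (i + 1)))
    (hN : s N r = 0) : Exec (loop r c) (s 0) (s N) := by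
  induction N generalizing s with
  | zero => exact exec_loop_zero hN
  | succ N ih =>
    exact exec_loop_succ (h 0 N.succ_pos).1 (h 0 N.succ_pos).2
      (ih (fun i => s (i + 1)) (fun i hi => h (i + 1) (by omega)) hN)

theorem exec_clear (r : ℕ) (σ : ℕ → ℕ) : Exec (loop r skip) σ (update σ r 0) := by
  have := exec_loop (r := r) (c := skip) (σ r) (fun i => update σ r (σ r - i))
    (fun i hi => ⟨by simp; omega, by
      convert exec_skip _ using 1
      ext x; simp only [update_apply]; grind⟩) (by simp)
  simpa using this

theorem exec_move {a o : ℕ} (hao : a ≠ o) (σ : ℕ → ℕ) :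
    Exec (loop a (inc o)) σ (update (update σ o (σ o + σ a)) a 0) := by
  have := exec_loop (r := a) (c := inc o) (σ a)
    (fun i => update (update σ o (σ o + i)) a (σ a - i))
    (fun i hi => ⟨by simp; omega, by
      convert exec_inc _ _ using 1
      ext x; simp only [update_apply]; grind⟩) (by simp)
  simpa using this

/-- Add register `a` to register `o`, with scratch register `t`. -/
def copy (a o t : ℕ) : RegProg :=
  seq (loop a (seq (inc o) (inc t))) (loop t (inc a))

theorem exec_copy {a o t : ℕ} (hao : a ≠ o) (hat : a ≠ t) (hot : o ≠ t) {σ : ℕ → ℕ}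
    (ht : σ t = 0) :
    Exec (copy a o t) σ (update σ o (σ o + σ a)) := by
  have h := exec_loop (r := a) (c := seq (inc o) (inc t)) (σ a)
    (fun i => update (update (update σ o (σ o + i)) t i) a (σ a - i))
    (fun i hi => ⟨by simp; omega, by
      convert (exec_inc _ _).seq (exec_inc _ _) using 1
      ext x; simp only [update_apply]; grind⟩) (by simp)
  unfold copy
  convert h.seq (exec_move hat.symm _) using 1
  · ext x; simp only [update_apply]; grind
  · ext x; simp only [update_apply]; grind

theorem exists_clear_range (m n : ℕ) : ∃ c : RegProg, ∀ σ : ℕ → ℕ,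
    Exec c σ (fun r => if m ≤ r ∧ r < m + n then 0 else σ r) := by
  induction n with
  | zero =>
    refine ⟨skip, fun σ => ?_⟩
    convert exec_skip σ using 1
    ext x; grind
  | succ n ih =>
    obtain ⟨c, hc⟩ := ih
    refine ⟨seq c (loop (m + n) skip), fun σ => ?_⟩
    convert (hc σ).seq (exec_clear _ _) using 1
    ext x; simp only [update_apply]; grind

/-- `c` adds `f (args)` to register `o`, using registers `≥ m` as scratch space. -/
def Computes {n : ℕ} (c : RegProg) (f : List.Vector ℕ n → ℕ) (args : Fin n → ℕ) (o m : ℕ) :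
    Prop :=
  ∀ σ : ℕ → ℕ, (∀ r ≥ m, σ r = 0) →
    Exec c σ (update σ o (σ o + f (List.Vector.ofFn fun i => σ (args i))))

theorem exists_computes_family {n k : ℕ} {g : Fin n → List.Vector ℕ k → ℕ} {args : Fin k → ℕ}
    {m : ℕ} (hargs : ∀ i, args i < m)
    (hg : ∀ i : Fin n, ∃ c, Computes c (g i) args (m + i) (m + n)) (j : ℕ) (hj : j ≤ n) :
    ∃ c, ∀ σ : ℕ → ℕ, (∀ r ≥ m, σ r = 0) → Exec c σ (fun r =>
      if m ≤ r ∧ r < m + j then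
        (if h : r - m < n then g ⟨r - m, h⟩ (List.Vector.ofFn fun i => σ (args i)) else 0)
      else σ r) := by
  induction j with
  | zero =>
    refine ⟨skip, fun σ _ => ?_⟩
    convert exec_skip σ using 1
    ext x; grind
  | succ j ih =>
    obtain ⟨c, hc⟩ := ih (by omega)
    obtain ⟨d, hd⟩ := hg ⟨j, hj⟩
    refine ⟨seq c d, fun σ hσ => ?_⟩
    convert (hc σ hσ).seq (hd _ ?_) using 1
    · have hv : ∀ i, ¬ (m ≤ args i ∧ args i < m + j) := fun i => by have := hargs i; omega
      ext x
      simp only [update_apply, hv, if_false]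
      by_cases hx : x = m + j
      · subst hx
        simp [show j < n from hj, hσ]
      · grind
    · intro r hr
      have := hσ r (by omega)
      grind

/-- Every primitive recursive function is computed by some program. -/
theorem exists_computes {n : ℕ} {f : List.Vector ℕ n → ℕ} (hf : Nat.Primrec' f) :
    ∀ (args : Fin n → ℕ) (o m : ℕ), (∀ i, args i < m) → o < m → (∀ i, args i ≠ o) →
      ∃ c, Computes c f args o m := by
  induction hf with
  | zero =>
    intro args o m _ _ _
    refine ⟨skip, fun σ _ => ?_⟩
    convert exec_skip σ using 1
    simp
  | succ =>
    intro args o m h1 h2 h3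
    refine ⟨seq (copy (args 0) o m) (inc o), fun σ hσ => ?_⟩
    convert (exec_copy (h3 0) (h1 0).ne h2.ne (hσ m le_rfl)).seq (exec_inc o _) using 1
    simp [List.Vector.ofFn]
    rfl
  | get i =>
    intro args o m h1 h2 h3
    refine ⟨copy (args i) o m, fun σ hσ => ?_⟩
    convert exec_copy (h3 i) (h1 i).ne h2.ne (hσ m le_rfl) using 1
    simp
  | @comp n k f g hf hg ihf ihg =>
    intro args o m h1 h2 h3
    obtain ⟨c, hc⟩ := exists_computes_family (n := k) (g := g) h1 (fun i =>
      ihg i args (m + i) (m + k) (fun j => by have := h1 j; omega) (by omega)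
        (fun j => by have := h1 j; omega)) k le_rfl
    obtain ⟨d, hd⟩ := ihf (fun i => m + i) o (m + k) (fun i => by simp) (by omega)
      (fun i => by omega)
    obtain ⟨e, he⟩ := exists_clear_range m k
    refine ⟨seq c (seq d e), fun σ hσ => ?_⟩
    convert (hc σ hσ).seq ((hd _ ?_).seq (he _)) using 1
    · ext x
      simp only [update_apply]
      by_cases hx : x = o
      · subst hx
        have : ¬ m ≤ x := by omega
        simp [this]
      · have := hσ x
        grind
    · intro r hr
      have := hσ r (by omega)
      grind
  | @prec n f g hf hg ihf ihg =>
    intro args o m h1 h2 h3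
    obtain ⟨c, hc⟩ := ihf (fun i => args i.succ) (m + 1) (m + 4)
      (fun j => by have := h1 j.succ; omega) (by omega) (fun j => by have := h1 j.succ; omega)
    obtain ⟨d, hd⟩ := ihg (Fin.cons m (Fin.cons (m + 1) fun i => args i.succ)) (m + 3) (m + 4)
      (fun j => by
        refine Fin.cases ?_ (fun j => Fin.cases ?_ (fun j => ?_) j) j
        · simp
        · simp
        · have := h1 j.succ; simp; omega) (by omega)
      (fun j => by
        refine Fin.cases ?_ (fun j => Fin.cases ?_ (fun j => ?_) j) j
        · simp
        · simp
        · have := h1 j.succ; simp; omega)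
    refine ⟨seq (copy (args 0) (m + 2) (m + 3))
      (seq c (seq (loop (m + 2)
        (seq d (seq (loop (m + 1) skip) (seq (loop (m + 3) (inc (m + 1))) (inc m)))))
        (seq (loop (m + 1) (inc o)) (loop m skip)))), fun σ hσ => ?_⟩
    set v : List.Vector ℕ n := List.Vector.ofFn fun i => σ (args i.succ) with hv
    let F : ℕ → ℕ := fun y => Nat.rec (f v) (fun y IH => g (y ::ᵥ IH ::ᵥ v)) y
    let s : ℕ → ℕ → ℕ := fun i => update (update (update σ m i) (m + 1) (F i)) (m + 2)
      (σ (args 0) - i)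
    have hF0 : F 0 = f v := rfl
    have hz : ∀ j, σ (m + j) = 0 := fun j => hσ _ (by omega)
    have hz0 : σ m = 0 := hσ _ le_rfl
    have h10 := h1 0
    have A1 := exec_copy (a := args 0) (o := m + 2) (t := m + 3) (σ := σ) (by omega) (by omega)
      (by omega) (hz 3)
    have A2 : Exec c (update σ (m + 2) (σ (m + 2) + σ (args 0))) (s 0) := by
      convert hc _ ?_ using 1
      · have : ∀ i : Fin n, args i.succ ≠ m + 2 := fun i => by have := h1 i.succ; omega
        ext x
        simp only [update_apply, this, if_false, s, ← hv, hF0]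
        grind
      · intro r hr
        have := hσ r (by omega)
        simp only [update_apply]; grind
    have A3 := exec_loop (r := m + 2)
      (c := seq d (seq (loop (m + 1) skip) (seq (loop (m + 3) (inc (m + 1))) (inc m))))
      (σ (args 0)) s (fun i hi => ⟨by simp [s]; omega, by
        convert (hd _ ?_).seq ((exec_clear _ _).seq
          ((exec_move (a := m + 3) (o := m + 1) (by omega) _).seq (exec_inc _ _))) using 1
        · have ha : ∀ i : Fin n, args i.succ ≠ m ∧ args i.succ ≠ m + 1 ∧ args i.succ ≠ m + 2 :=
            fun i => by have := h1 i.succ; omega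
          have hvec : (List.Vector.ofFn fun j : Fin (n + 2) =>
              update (s i) (m + 2) (s i (m + 2) - 1)
                ((Fin.cons m (Fin.cons (m + 1) fun i => args i.succ) : Fin (n + 2) → ℕ) j))
              = i ::ᵥ F i ::ᵥ v := by
            simp [List.Vector.ofFn, s, ha, hv]
          rw [hvec]
          have hF : F (i + 1) = g (i ::ᵥ F i ::ᵥ v) := rfl
          have := hz 3
          ext x
          simp only [update_apply, s, hF]
          grind
        · intro r hr
          have := hσ r (by omega)
          simp only [update_apply, s]; grind⟩) (by simp [s])
    convert A1.seq (A2.seq (A3.seq ((exec_move (a := m + 1) (o := o) (by omega) _).seq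
      (exec_clear m _)))) using 1
    have hres : (List.Vector.ofFn fun i => σ (args i)) = σ (args 0) ::ᵥ v := rfl
    have hFN : F (σ (args 0)) = Nat.rec (f v) (fun y IH => g (y ::ᵥ IH ::ᵥ v)) (σ (args 0)) := rfl
    have := hz 1
    have := hz 2
    ext x
    simp only [update_apply, s, hres, List.Vector.head_cons, List.Vector.tail_cons, ← hFN]
    grind

/-- Unbounded search for a zero of `f n` by a program which clears all registers on halting. -/
theorem exists_search {f : ℕ → ℕ → ℕ} (hf : Primrec₂ f) : ∃ c : RegProg, ∀ n,
    ((∃ t, f n t = 0) → ∃ j, step^[j] ([c], update 0 0 n) = ([], 0)) ∧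
    ((∀ t, f n t ≠ 0) → ∀ j, (step^[j] ([c], update 0 0 n)).1 ≠ []) := by
  obtain ⟨d, hd⟩ := exists_computes (Nat.Primrec'.prim_iff₂.2 hf) ![0, 1] 2 3
    (fun i => by fin_cases i <;> simp) (by omega) (fun i => by fin_cases i <;> simp)
  let body : RegProg := seq (loop 2 skip) (seq (inc 1) d)
  let fin : RegProg := seq (loop 0 skip) (loop 1 skip)
  refine ⟨seq d (seq (loop 2 body) fin), fun n => ?_⟩
  let st : ℕ → ℕ → ℕ → ℕ := fun t v => update (update (update 0 0 n) 1 t) 2 v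
  have hst (t : ℕ) : Exec d (st t 0) (st t (f n t)) := by
    convert hd (st t 0) ?_ using 1
    · ext x
      simp [update_apply, st, List.Vector.ofFn]
      grind
    · intro r hr
      simp only [update_apply, st, Pi.zero_apply]; grind
  have hbody (t v : ℕ) : Exec body (st t v) (st (t + 1) (f n (t + 1))) := by
    refine (exec_clear 2 _).seq ((exec_inc 1 _).seq ?_)
    convert hst (t + 1) using 1
    ext x; simp only [update_apply, st]; grind
  have hreach (t : ℕ) (ht : ∀ t' < t, f n t' ≠ 0) :
      ∃ j ≥ t, step^[j] ([seq d (seq (loop 2 body) fin)], update 0 0 n) =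
        ([loop 2 body, fin], st t (f n t)) := by
    induction t with
    | zero =>
      obtain ⟨i, hi⟩ := hst 0 [seq (loop 2 body) fin]
      have h0 : st 0 0 = (update 0 0 n : ℕ → ℕ) := by
        ext x; simp only [update_apply, st, Pi.zero_apply]; clear * -; grind
      refine ⟨1 + (i + 1), by omega, ?_⟩
      rw [iterate_add_apply, iterate_succ_apply _ i, step, ← h0, hi]
      rfl
    | succ t ih =>
      obtain ⟨j, hj, hjs⟩ := ih fun t' ht' => ht t' (by omega)
      obtain ⟨i, hi⟩ := hbody t (f n t - 1) [loop 2 body, fin]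
      refine ⟨i + (1 + j), by omega, ?_⟩
      have h1 : step ([loop 2 body, fin], st t (f n t)) =
          (body :: [loop 2 body, fin], st t (f n t - 1)) := by
        have : st t (f n t) 2 ≠ 0 := by simpa [st] using ht t (by omega)
        rw [step, if_neg this]
        simp [st]
      rw [iterate_add_apply, iterate_add_apply, hjs, iterate_one, h1, hi]
  constructor
  · intro h
    classical
    obtain ⟨j, -, hj⟩ := hreach (Nat.find h) fun t' ht' => Nat.find_min h ht'
    have h0 : f n (Nat.find h) = 0 := Nat.find_spec h
    obtain ⟨i, hi⟩ := exec_loop_zero (r := 2) (c := body) (σ := st (Nat.find h) 0)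
      (by simp [st]) [fin]
    obtain ⟨l, hl⟩ := (exec_clear 0 (st (Nat.find h) 0)).seq (exec_clear 1 _) []
    refine ⟨l + (i + j), ?_⟩
    rw [iterate_add_apply, iterate_add_apply, hj, h0, hi, hl]
    congr 1
    ext x; simp only [update_apply, st, Pi.zero_apply]; clear * -; grind
  · intro h j hj
    obtain ⟨i, hi, his⟩ := hreach j fun t' _ => h t'
    obtain ⟨l, rfl⟩ := Nat.exists_eq_add_of_le' hi
    have hfix (σ : ℕ → ℕ) : step^[l] ([], σ) = ([], σ) := iterate_fixed rfl l
    rw [iterate_add_apply, show step^[j] _ = ([], _) from Prod.ext hj rfl, hfix] at his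
    simp at his

/-- The lists of programs reached before the list `k` when executing `c :: k`. -/
def supp : RegProg → List RegProg → Set (List RegProg)
  | skip, k => {skip :: k}
  | inc r, k => {inc r :: k}
  | seq a b, k => {seq a b :: k} ∪ (supp a (b :: k) ∪ supp b k)
  | loop r c, k => {loop r c :: k} ∪ supp c (loop r c :: k)

theorem finite_supp (c : RegProg) (k : List RegProg) : (supp c k).Finite := by
  induction c generalizing k with
  | skip => exact Set.finite_singleton _
  | inc r => exact Set.finite_singleton _
  | seq a b iha ihb => exact (Set.finite_singleton _).union ((iha _).union (ihb _))
  | loop r c ih => exact (Set.finite_singleton _).union (ih _)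

theorem cons_mem_supp (c : RegProg) (k : List RegProg) : c :: k ∈ supp c k := by
  cases c <;> simp [supp]

theorem step_mem_supp (c : RegProg) (k : List RegProg) {K : List RegProg} (hK : K ∈ supp c k)
    (σ : ℕ → ℕ) : (step (K, σ)).1 ∈ supp c k ∨ (step (K, σ)).1 = k := by
  induction c generalizing k with
  | skip => simp_all [supp, step]
  | inc r => simp_all [supp, step]
  | seq a b iha ihb =>
    simp only [supp, Set.mem_union, Set.mem_singleton_iff] at hK ⊢
    rcases hK with rfl | hK | hK
    · simp [step, cons_mem_supp]
    · rcases iha _ hK with h | h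
      · simp [h]
      · simp [h, cons_mem_supp]
    · rcases ihb _ hK with h | h <;> simp [h]
  | loop r c ih =>
    simp only [supp, Set.mem_union, Set.mem_singleton_iff] at hK ⊢
    rcases hK with rfl | hK
    · by_cases h : σ r = 0 <;> simp [step, h, cons_mem_supp]
    · rcases ih _ hK with h | h <;> simp [h]

/-- The register used by the first program of a list. -/
def headReg : List RegProg → ℕ
  | inc r :: _ => r
  | loop r _ :: _ => r
  | _ => 0

/-- The fraction simulating `step` on the codes `p K * ∏ r, q r ^ σ r` of configurations
`(K, σ)`; `x` is any number divisible by the same `q r` as the code. -/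
def fraction (p : List RegProg → ℕ) (q : ℕ → ℕ) : List RegProg → ℕ → ℕ × ℕ
  | [], _ => (1, p [])
  | skip :: k, _ => (p k, p (skip :: k))
  | inc r :: k, _ => (p k * q r, p (inc r :: k))
  | seq a b :: k, _ => (p (a :: b :: k), p (seq a b :: k))
  | loop r c :: k, x =>
    if q r ∣ x then (p (c :: loop r c :: k), p (loop r c :: k) * q r)
    else (p k, p (loop r c :: k))

/-- The code of a configuration, taking into account the registers below `M`. -/
def code (p : List RegProg → ℕ) (q : ℕ → ℕ) (M : ℕ) (c : List RegProg × (ℕ → ℕ)) : ℕ :=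
  p c.1 * ∏ r ∈ Finset.range M, q r ^ c.2 r

theorem prod_pow_update {q : ℕ → ℕ} {M r : ℕ} (hr : r < M) (σ : ℕ → ℕ) (v : ℕ) :
    ∏ i ∈ Finset.range M, q i ^ update σ r v i =
      q r ^ v * ∏ i ∈ (Finset.range M).erase r, q i ^ σ i := by
  rw [← Finset.mul_prod_erase _ _ (Finset.mem_range.2 hr), update_self]
  congr 1
  refine Finset.prod_congr rfl fun i hi => ?_
  rw [update_of_ne (Finset.ne_of_mem_erase hi)]

theorem prod_pow_eq {q : ℕ → ℕ} {M r : ℕ} (hr : r < M) (σ : ℕ → ℕ) :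
    ∏ i ∈ Finset.range M, q i ^ σ i =
      q r ^ σ r * ∏ i ∈ (Finset.range M).erase r, q i ^ σ i :=
  (Finset.mul_prod_erase _ _ (Finset.mem_range.2 hr)).symm

theorem eq_of_dvd_code {p : List RegProg → ℕ} {q : ℕ → ℕ} (hp : ∀ K, (p K).Prime)
    (hq : ∀ r, (q r).Prime) {M : ℕ} (hpq : ∀ K, ∀ r < M, p K ≠ q r) {K K' : List RegProg}
    {σ : ℕ → ℕ} (h : p K ∣ code p q M (K', σ)) : p K = p K' := by
  rcases (hp K).dvd_mul.1 h with h | h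
  · exact (Nat.prime_dvd_prime_iff_eq (hp K) (hp K')).1 h
  · obtain ⟨r, hr, h⟩ := (hp K).prime.exists_mem_finset_dvd h
    exact absurd ((Nat.prime_dvd_prime_iff_eq (hp K) (hq r)).1 ((hp K).dvd_of_dvd_pow h))
      (hpq K r (Finset.mem_range.1 hr))

theorem dvd_code_iff {p : List RegProg → ℕ} {q : ℕ → ℕ} (hp : ∀ K, (p K).Prime)
    (hq : ∀ r, (q r).Prime) (hqi : Injective q) {M : ℕ} (hpq : ∀ K, ∀ r < M, p K ≠ q r)
    {K : List RegProg} {σ : ℕ → ℕ} {r : ℕ} (hr : r < M) :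
    q r ∣ code p q M (K, σ) ↔ σ r ≠ 0 := by
  constructor
  · intro h h0
    rcases (hq r).dvd_mul.1 h with h | h
    · exact hpq K r hr ((Nat.prime_dvd_prime_iff_eq (hq r) (hp K)).1 h).symm
    · obtain ⟨i, hi, h⟩ := (hq r).prime.exists_mem_finset_dvd h
      have := hqi ((Nat.prime_dvd_prime_iff_eq (hq r) (hq i)).1 ((hq r).dvd_of_dvd_pow h))
      subst this
      simp only [h0, pow_zero, Nat.dvd_one] at h
      exact (hq r).one_lt.ne' h
  · intro h
    rw [code, prod_pow_eq hr]
    exact Dvd.dvd.mul_left (Dvd.dvd.mul_right (dvd_pow_self _ h) _) _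

theorem code_mul_fraction {p : List RegProg → ℕ} {q : ℕ → ℕ} (hp : ∀ K, (p K).Prime)
    (hq : ∀ r, (q r).Prime) (hqi : Injective q) {M : ℕ} (hpq : ∀ K, ∀ r < M, p K ≠ q r)
    {K : List RegProg} (hK : K ≠ []) (hM : headReg K < M) (σ : ℕ → ℕ) {x : ℕ}
    (hx : q (headReg K) ∣ x ↔ q (headReg K) ∣ code p q M (K, σ)) :
    code p q M (K, σ) * (fraction p q K x).1 / (fraction p q K x).2 =
      code p q M (step (K, σ)) := by
  have hp0 (K) : 0 < p K := (hp K).pos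
  have hq0 (r) : 0 < q r := (hq r).pos
  match K, hK with
  | skip :: k, _ =>
    refine Nat.div_eq_of_eq_mul_right (hp0 _) ?_
    simp only [code, step, fraction]; ring
  | inc r :: k, _ =>
    refine Nat.div_eq_of_eq_mul_right (hp0 _) ?_
    simp only [headReg] at hM
    simp only [code, step, fraction]
    rw [prod_pow_update hM, prod_pow_eq hM]; ring
  | seq a b :: k, _ =>
    refine Nat.div_eq_of_eq_mul_right (hp0 _) ?_
    simp only [code, step, fraction]; ring
  | loop r c :: k, _ =>
    rw [dvd_code_iff hp hq hqi hpq hM] at hx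
    simp only [headReg] at hx hM
    by_cases h : σ r = 0
    · rw [fraction, if_neg (by simpa [h] using hx), step, if_pos h]
      refine Nat.div_eq_of_eq_mul_right (hp0 _) ?_
      simp only [code]; ring
    · rw [fraction, if_pos (hx.2 h), step, if_neg h]
      refine Nat.div_eq_of_eq_mul_right (Nat.mul_pos (hp0 _) (hq0 _)) ?_
      obtain ⟨s, hs⟩ := Nat.exists_eq_succ_of_ne_zero h
      simp only [code]
      rw [prod_pow_update hM, prod_pow_eq (r := r) hM, hs]
      simp only [Nat.succ_eq_add_one, Nat.add_sub_cancel]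
      ring

theorem fraction_pos {p : List RegProg → ℕ} {q : ℕ → ℕ} (hp : ∀ K, (p K).Prime)
    (hq : ∀ r, (q r).Prime) (K : List RegProg) (x : ℕ) :
    0 < (fraction p q K x).1 ∧ 0 < (fraction p q K x).2 := by
  have hp0 (K) : 0 < p K := (hp K).pos
  have hq0 (r) : 0 < q r := (hq r).pos
  unfold fraction
  split <;> try split
  all_goals simp [hp0, hq0]

theorem fraction_snd_dvd (p : List RegProg → ℕ) (q : ℕ → ℕ) (K : List RegProg) (x : ℕ) :
    (fraction p q K x).2 ∣ p K * q (headReg K) := by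
  unfold fraction
  split <;> try split
  all_goals simp [headReg]

theorem fraction_snd_dvd_of_dvd {p : List RegProg → ℕ} {q : ℕ → ℕ} {K : List RegProg} {x : ℕ}
    (h : p K ∣ x) (hc : (p K).Coprime (q (headReg K))) : (fraction p q K x).2 ∣ x := by
  unfold fraction
  split <;> try split
  all_goals try exact h
  exact hc.mul_dvd_of_dvd_of_dvd h (by assumption)

/-- A table of fractions, indexed by the residues modulo `γ`, which simulates `step` on the
configurations with first component in `S`. -/
theorem exists_table {S : Set (List RegProg)} (hS : S.Finite) (hnil : [] ∈ S) :
    ∃ (γ : ℕ) (T : ℕ → ℕ × ℕ) (e : List RegProg × (ℕ → ℕ) → ℕ), 3 ≤ γ ∧ 2 ∣ γ ∧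
      (∀ x, 0 < (T x).1 ∧ 0 < (T x).2 ∧ (T x).2 ∣ γ ∧ (T x).2 ∣ x) ∧ T 1 = (1, 1) ∧
      (∀ K ∈ S, ∀ σ, e (K, σ) ≠ 1 ∧ e (K, σ) % γ ≠ 2 ∧ (K ≠ [] →
        e (K, σ) * (T (e (K, σ) % γ)).1 / (T (e (K, σ) % γ)).2 = e (step (K, σ)))) ∧
      e ([], 0) * (T (e ([], 0) % γ)).1 / (T (e ([], 0) % γ)).2 = 1 ∧
      ∀ K, ∃ A, 0 < A ∧ ∀ n, e (K, update 0 0 n) = A * 2 ^ n := by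
  classical
  obtain ⟨i, hi⟩ := Set.countable_iff_exists_injOn.1 hS.countable
  lift S to Finset (List RegProg) using hS
  simp only [Finset.mem_coe] at *
  let M := S.sup headReg + 1
  have hM : ∀ K ∈ S, headReg K < M := fun K hK => Nat.lt_succ_of_le (Finset.le_sup hK)
  let q : ℕ → ℕ := Nat.nth Nat.Prime
  let p : List RegProg → ℕ := fun K => Nat.nth Nat.Prime (M + i K)
  have hq : ∀ r, (q r).Prime := Nat.prime_nth_prime
  have hp : ∀ K, (p K).Prime := fun K => Nat.prime_nth_prime _
  have hqi : Injective q := Nat.nth_injective Nat.infinite_setOfPred_prime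
  have hpq : ∀ K, ∀ r < M, p K ≠ q r := fun K r hr h => by have := hqi h; omega
  have hpi : ∀ K ∈ S, ∀ K' ∈ S, p K = p K' → K = K' := fun K hK K' hK' h =>
    hi hK hK' (by have := hqi h; omega)
  have hq0 : q 0 = 2 := Nat.nth_prime_zero_eq_two
  have hp2 : ∀ K, 2 < p K := fun K =>
    lt_of_le_of_ne (hp K).two_le (hq0 ▸ (hpq K 0 (by omega)).symm)
  let γ := (∏ K ∈ S, p K) * ∏ r ∈ Finset.range M, q r
  have hγ0 : 0 < γ := Nat.mul_pos (Finset.prod_pos fun K _ => (hp K).pos)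
    (Finset.prod_pos fun r _ => (hq r).pos)
  have hpγ : ∀ K ∈ S, p K ∣ γ := fun K hK => (Finset.dvd_prod_of_mem p hK).mul_right _
  have hqγ : ∀ r < M, q r ∣ γ := fun r hr =>
    (Finset.dvd_prod_of_mem q (Finset.mem_range.2 hr)).mul_left _
  have hpqγ : ∀ K ∈ S, p K * q (headReg K) ∣ γ := fun K hK =>
    mul_dvd_mul (Finset.dvd_prod_of_mem p hK)
      (Finset.dvd_prod_of_mem q (Finset.mem_range.2 (hM K hK)))
  let T : ℕ → ℕ × ℕ := fun x =>
    if h : ∃ K ∈ S, p K ∣ x then fraction p q h.choose x else (1, 1)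
  have hTcode : ∀ K ∈ S, ∀ σ, T (code p q M (K, σ) % γ) =
      fraction p q K (code p q M (K, σ) % γ) := by
    intro K hK σ
    have h : ∃ K' ∈ S, p K' ∣ code p q M (K, σ) % γ :=
      ⟨K, hK, (Nat.dvd_mod_iff (hpγ K hK)).2 (Dvd.intro _ rfl)⟩
    have h' : h.choose = K := hpi _ h.choose_spec.1 _ hK
      (eq_of_dvd_code hp hq hpq ((Nat.dvd_mod_iff (hpγ _ h.choose_spec.1)).1 h.choose_spec.2))
    simp only [T, dif_pos h, h']
  refine ⟨γ, T, code p q M, ?_, ?_, ?_, ?_, ?_, ?_, ?_⟩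
  · exact (hp2 []).trans_le (Nat.le_of_dvd hγ0 (hpγ _ hnil))
  · exact hq0 ▸ hqγ 0 (by omega)
  · intro x
    by_cases h : ∃ K ∈ S, p K ∣ x
    · have hS := h.choose_spec.1
      simp only [T, dif_pos h]
      exact ⟨(fraction_pos hp hq _ _).1, (fraction_pos hp hq _ _).2,
        (fraction_snd_dvd p q _ _).trans (hpqγ _ hS),
        fraction_snd_dvd_of_dvd h.choose_spec.2
          ((Nat.coprime_primes (hp _) (hq _)).2 (hpq _ _ (hM _ hS)))⟩
    · simp [T, dif_neg h]
  · have h : ¬ ∃ K ∈ S, p K ∣ 1 := by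
      rintro ⟨K, -, h⟩
      exact (hp K).one_lt.ne' (Nat.dvd_one.1 h)
    simp only [T, dif_neg h]
  · intro K hK σ
    have hd : p K ∣ code p q M (K, σ) := Dvd.intro _ rfl
    refine ⟨fun h => (hp K).one_lt.ne' (Nat.dvd_one.1 (h ▸ hd)), fun h => ?_, fun hne => ?_⟩
    · have := Nat.le_of_dvd two_pos (h ▸ (Nat.dvd_mod_iff (hpγ K hK)).2 hd)
      exact absurd this (hp2 K).not_ge
    · rw [hTcode K hK]
      exact code_mul_fraction hp hq hqi hpq hne (hM K hK) σ
        (Nat.dvd_mod_iff (hqγ _ (hM K hK)))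
  · rw [hTcode _ hnil]
    simp [code, fraction, (hp []).pos]
  · intro K
    refine ⟨p K, (hp K).pos, fun n => ?_⟩
    rw [code, prod_pow_update (by omega), hq0]
    simp

end RegProg

/-- The list `u 0, u 1, v, u 3, …, u (γ - 1)`. -/
def tableList (u : ℕ → ℕ) (v γ : ℕ) : List ℕ :=
  u 0 :: u 1 :: v :: (List.range (γ - 3)).map fun k => u (k + 3)

theorem tableList_getD (u : ℕ → ℕ) (v : ℕ) {γ k : ℕ} (hk : k < γ) :
    (tableList u v γ).getD k 0 = if k = 2 then v else u k := by
  match k with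
  | 0 => rfl
  | 1 => rfl
  | 2 => rfl
  | k + 3 =>
    have : k < γ - 3 := by omega
    simp [tableList, this]

theorem forall_mem_tableList {u : ℕ → ℕ} {v γ : ℕ} {P : ℕ → Prop} (hu : ∀ k, P (u k))
    (hv : P v) : ∀ a ∈ tableList u v γ, P a := by
  simp only [tableList, List.mem_cons, List.mem_map]
  rintro a (rfl | rfl | rfl | ⟨k, -, rfl⟩)
  exacts [hu _, hu _, hv, hu _]

open RegProg in
/-- The zero search of a primitive recursive function is simulated by Conway functions which
depend on the parameter `n` in a single entry only. -/
theorem exists_conway_search {f : ℕ → ℕ → ℕ} (hf : Primrec₂ f) :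
    ∃ (γ A : ℕ) (u w : ℕ → ℕ), ∀ n,
      ConwayData γ (tableList u (A * 2 ^ n) γ) (tableList w 2 γ) ∧
      (ConwayStops γ (tableList u (A * 2 ^ n) γ) (tableList w 2 γ) ↔ ∃ t, f n t = 0) := by
  obtain ⟨c, hc⟩ := exists_search hf
  let S : Set (List RegProg) := insert [] (supp c [])
  have hstep : ∀ K ∈ S, ∀ σ, (step (K, σ)).1 ∈ S := by
    rintro K (rfl | hK) σ
    · exact Or.inl rfl
    · exact (step_mem_supp c [] hK σ).symm
  obtain ⟨γ, T, e, hγ, h2, hT, hT1, he, henil, hA⟩ :=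
    exists_table ((finite_supp c []).insert []) (Set.mem_insert _ _)
  obtain ⟨A, hA0, hA⟩ := hA [c]
  refine ⟨γ, A, fun x => (T x).1, fun x => (T x).2, fun n => ⟨⟨by omega, ?_, ?_, ?_, ?_, ?_⟩, ?_⟩⟩
  · simp [tableList]; omega
  · simp [tableList]; omega
  · exact forall_mem_tableList (fun k => (hT k).1) (Nat.mul_pos hA0 (by positivity))
  · exact forall_mem_tableList (fun k => (hT k).2.1) (by omega)
  · intro k hk
    rw [tableList_getD _ _ hk, tableList_getD _ _ hk]
    split_ifs with h
    · subst h
      exact ⟨h2, Dvd.intro _ rfl⟩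
    · exact ⟨(hT k).2.2.1, (hT k).2.2.2.mul_right _⟩
  set F := conwayF γ (tableList (fun x => (T x).1) (A * 2 ^ n) γ)
    (tableList (fun x => (T x).2) 2 γ) with hF
  have hF_apply (m : ℕ) (hm : m % γ ≠ 2) : F m = m * (T (m % γ)).1 / (T (m % γ)).2 := by
    have hlt : m % γ < γ := Nat.mod_lt _ (by omega)
    rw [hF, conwayF, tableList_getD _ _ hlt, tableList_getD _ _ hlt, if_neg hm, if_neg hm]
  have hF2 : F 2 = e ([c], Function.update 0 0 n) := by
    have hlt : 2 < γ := hγ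
    rw [hF, conwayF, Nat.mod_eq_of_lt hlt, tableList_getD _ _ hlt, tableList_getD _ _ hlt, hA]
    simp
  have hF1 : F 1 = 1 := by
    rw [hF_apply] <;> rw [Nat.mod_eq_of_lt (by omega)]
    · simp [hT1]
    · simp
  have hmem (j : ℕ) : (step^[j] ([c], Function.update 0 0 n)).1 ∈ S := by
    induction j with
    | zero => exact Or.inr (cons_mem_supp c [])
    | succ j ih =>
      rw [Function.iterate_succ_apply']
      exact hstep _ ih _
  have hsim (j : ℕ) (hj : ∀ i < j, (step^[i] ([c], Function.update 0 0 n)).1 ≠ []) :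
      F^[j + 1] 2 = e (step^[j] ([c], Function.update 0 0 n)) := by
    induction j with
    | zero => exact hF2
    | succ j ih =>
      have h := he _ (hmem j) (step^[j] ([c], Function.update 0 0 n)).2
      rw [Function.iterate_succ_apply', ih fun i hi => hj i (by omega),
        Function.iterate_succ_apply', hF_apply _ h.2.1]
      exact h.2.2 (hj j (by omega))
  constructor
  · rintro ⟨N, hN⟩
    by_contra! h
    have hne := (hc n).2 h
    have h1 : F^[N + 1] 2 = 1 := by rw [Function.iterate_succ_apply', hN, hF1]
    rw [hsim N fun i _ => hne i] at h1
    exact (he _ (hmem N) _).1 h1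
  · intro h
    classical
    obtain ⟨j, hj⟩ := (hc n).1 h
    have hex : ∃ i, (step^[i] ([c], Function.update 0 0 n)).1 = [] := ⟨j, by rw [hj]⟩
    have hmin : step^[Nat.find hex] ([c], Function.update 0 0 n) = ([], 0) := by
      obtain ⟨l, hl⟩ := Nat.exists_eq_add_of_le' (Nat.find_min' hex (by rw [hj]) :
        Nat.find hex ≤ j)
      have hfix (σ : ℕ → ℕ) : step^[l] ([], σ) = ([], σ) := Function.iterate_fixed rfl l
      have h0 : step^[Nat.find hex] ([c], Function.update 0 0 n) = ([], _) :=
        Prod.ext (Nat.find_spec hex) rfl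
      rw [hl, Function.iterate_add_apply, h0, hfix] at hj
      rw [h0, hj]
    refine ⟨Nat.find hex + 1 + 1, ?_⟩
    rw [Function.iterate_succ_apply', hsim _ fun i hi => Nat.find_min hex hi, hmin]
    exact (hF_apply _ (he _ (Set.mem_insert _ _) _).2.1).trans henil

theorem exists_primrec_eval_dom_iff : ∃ f : ℕ → ℕ → ℕ, Primrec₂ f ∧
    ∀ c : Nat.Partrec.Code, (c.eval 0).Dom ↔ ∃ t, f (Encodable.encode c) t = 0 := by
  refine ⟨fun n t => Option.casesOn
    (Nat.Partrec.Code.evaln t (Denumerable.ofNat Nat.Partrec.Code n) 0) 1 fun _ => 0, ?_, ?_⟩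
  · exact Primrec.option_casesOn (Nat.Partrec.Code.primrec_evaln.comp (Primrec.pair
      (Primrec.pair Primrec.snd ((Primrec.ofNat _).comp Primrec.fst)) (Primrec.const 0)))
      (Primrec.const 1) (Primrec.const 0).to₂
  · intro c
    simp only [Denumerable.ofNat_encode, Part.dom_iff_mem, Nat.Partrec.Code.evaln_complete]
    rw [exists_comm]
    refine exists_congr fun t => ?_
    cases h : Nat.Partrec.Code.evaln t c 0 <;> simp

/-- Theorem 7: it is undecidable whether the Conway function defined by
a given sequence stops. -/
theorem conway_stopping_undecidable :
    ¬ ComputablePred (fun x : ℕ × List ℕ × List ℕ =>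
        ConwayData x.1 x.2.1 x.2.2 ∧ ConwayStops x.1 x.2.1 x.2.2) := by
  intro h
  obtain ⟨f, hf, hdom⟩ := exists_primrec_eval_dom_iff
  obtain ⟨γ, A, u, w, hC⟩ := exists_conway_search hf
  refine ComputablePred.halting_problem 0 (ComputablePred.computable_of_manyOneReducible
    ⟨fun c => (γ, tableList u (A * 2 ^ Encodable.encode c) γ, tableList w 2 γ), ?_, fun c => ?_⟩ h)
  · have hpow : Primrec fun n : ℕ => 2 ^ n :=
      (Primrec₂.unpaired'.1 Nat.Primrec.pow).comp (Primrec.const 2) Primrec.id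
    have hentry : Primrec fun c : Nat.Partrec.Code => A * 2 ^ Encodable.encode c :=
      Primrec.nat_mul.comp (Primrec.const A) (hpow.comp Primrec.encode)
    exact (Primrec.pair (Primrec.const γ) (Primrec.pair
      (Primrec.list_cons.comp (Primrec.const _) (Primrec.list_cons.comp (Primrec.const _)
        (Primrec.list_cons.comp hentry (Primrec.const _)))) (Primrec.const _))).to_comp
  · exact (hdom c).trans ((hC _).2.symm.trans (and_iff_right (hC _).1).symm)
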